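/- Let k be a field and (V, ≤) a finite partially ordered set, and let A = k[V×{1,2}]/L be the edge ring of the associated bipartite graph. Then A is Cohen–Macaulay in the following sense: there exists a regular sequence a₁,…,aₙ in A of length n = |V| such that A/(a₁,…,aₙ) is finite-dimensional as a k-vector space. Moreover, the Krull dimension of A equals |V|. -/

import Mathlib

open MvPolynomial

/-- A sequence `a₁, …, aₙ` (given as a list) in a commutative ring `A` is regular
if each `aᵢ` is a nonzerodivisor in `A/(a₁,…,a_{i-1})` and all the quotient rings
`A/(a₁,…,aᵢ)`, `i = 0, …, n`, are nonzero. -/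
def IsRegularSeq {A : Type*} [CommRing A] (l : List A) : Prop :=
  (∀ i : Fin l.length, ∀ b : A,
      Ideal.Quotient.mk (Ideal.span {a | a ∈ l.take i.val}) (l.get i * b) = 0 →
      Ideal.Quotient.mk (Ideal.span {a | a ∈ l.take i.val}) b = 0) ∧
  (∀ i : ℕ, i ≤ l.length → (Ideal.span {a | a ∈ l.take i} : Ideal A) ≠ ⊤)

/-- The edge ideal of the bipartite graph associated to a poset `V`. -/
noncomputable def posetEdgeIdeal (k V : Type*) [Field k] [PartialOrder V] :
    Ideal (MvPolynomial (V ⊕ V) k) :=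
  Ideal.span {p | ∃ v w : V, v ≤ w ∧ p = X (Sum.inl v) * X (Sum.inr w)}

section Regularity

variable {k V : Type*} [Field k] [PartialOrder V]

/-- The monomial ideal generated by `x_{(v,1)} * x_{σ w}` for `v ≤ w`. -/
noncomputable def twistedEdgeIdeal (k : Type*) [Field k] (σ : V → V ⊕ V) :
    Ideal (MvPolynomial (V ⊕ V) k) :=
  Ideal.span {p | ∃ v w : V, v ≤ w ∧ p = X (Sum.inl v) * X (σ w)}

lemma mem_twistedEdgeIdeal_iff (σ : V → V ⊕ V) (f : MvPolynomial (V ⊕ V) k) :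
    f ∈ twistedEdgeIdeal k σ ↔ ∀ m ∈ f.support, ∃ v w : V, v ≤ w ∧
      Finsupp.single (Sum.inl v) 1 + Finsupp.single (σ w) 1 ≤ m := by
  have h : {p : MvPolynomial (V ⊕ V) k | ∃ v w : V, v ≤ w ∧ p = X (Sum.inl v) * X (σ w)} =
      (fun s => monomial s (1 : k)) '' {s | ∃ v w : V, v ≤ w ∧
        s = Finsupp.single (Sum.inl v) 1 + Finsupp.single (σ w) 1} := by
    ext p
    constructor
    · rintro ⟨v, w, hvw, rfl⟩
      exact ⟨_, ⟨v, w, hvw, rfl⟩, by simp [X, monomial_mul]⟩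
    · rintro ⟨_, ⟨v, w, hvw, rfl⟩, rfl⟩
      exact ⟨v, w, hvw, by simp [X, monomial_mul]⟩
  rw [twistedEdgeIdeal, h, mem_ideal_span_monomial_image]
  refine forall₂_congr fun m _ => ⟨?_, ?_⟩
  · rintro ⟨_, ⟨v, w, hvw, rfl⟩, hm⟩
    exact ⟨v, w, hvw, hm⟩
  · rintro ⟨v, w, hvw, hm⟩
    exact ⟨_, ⟨v, w, hvw, rfl⟩, hm⟩

lemma exists_le_of_X_sq_mul_mem {σ : V → V ⊕ V} {f : MvPolynomial (V ⊕ V) k} {a : V ⊕ V}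
    (h : X a ^ 2 * f ∈ twistedEdgeIdeal k σ) {m : V ⊕ V →₀ ℕ} (hm : m ∈ f.support) :
    ∃ v w : V, v ≤ w ∧
      Finsupp.single (Sum.inl v) 1 + Finsupp.single (σ w) 1 ≤ Finsupp.single a 2 + m := by
  refine (mem_twistedEdgeIdeal_iff σ _).1 h _ ?_
  rw [mem_support_iff] at hm ⊢
  rwa [X_pow_eq_monomial, coeff_monomial_mul, one_mul]

lemma mem_twistedEdgeIdeal_of_X_sq_mul_mem {σ : V → V ⊕ V}
    (hσ : ∀ w, σ w = Sum.inl w ∨ σ w = Sum.inr w) {u : V} (hu : σ u = Sum.inr u)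
    {f : MvPolynomial (V ⊕ V) k}
    (hx : X (Sum.inl u) ^ 2 * f ∈ twistedEdgeIdeal k σ)
    (hy : X (Sum.inr u) ^ 2 * f ∈ twistedEdgeIdeal k σ) :
    f ∈ twistedEdgeIdeal k σ := by
  classical
  rw [mem_twistedEdgeIdeal_iff]
  intro m hm
  obtain ⟨v, w, hvw, h₁⟩ := exists_le_of_X_sq_mul_mem hx hm
  obtain ⟨v', w', hvw', h₂⟩ := exists_le_of_X_sq_mul_mem hy hm
  by_contra! hcon
  have hw : σ w ≠ Sum.inl u := fun h => by
    rcases hσ w with h' | h' <;> grind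
  have hv : v = u := by
    by_contra hne
    refine hcon v w hvw fun t => ?_
    have := h₁ t
    simp only [Finsupp.add_apply, Finsupp.single_apply] at this ⊢
    grind
  have hw' : w' = u := by
    by_contra hne
    refine hcon v' w' hvw' fun t => ?_
    have := h₂ t
    have := hσ w'
    simp only [Finsupp.add_apply, Finsupp.single_apply] at *
    grind
  subst hv hw'
  refine hcon v' w (hvw'.trans hvw) fun t => ?_
  have e₁ := h₁ (σ w)
  have e₂ := h₂ (Sum.inl v')
  have := hσ w
  have : σ w ≠ Sum.inl v' := fun h => by
    have : w = v' := by grind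
    subst this
    exact hw (by rw [h, le_antisymm hvw hvw'])
  simp only [Finsupp.add_apply, Finsupp.single_apply] at *
  grind

lemma mem_twistedEdgeIdeal_of_X_sub_X_mul_mem {σ : V → V ⊕ V}
    (hσ : ∀ w, σ w = Sum.inl w ∨ σ w = Sum.inr w) {u : V} (hu : σ u = Sum.inr u)
    {f : MvPolynomial (V ⊕ V) k}
    (h : (X (Sum.inl u) - X (Sum.inr u)) * f ∈ twistedEdgeIdeal k σ) :
    f ∈ twistedEdgeIdeal k σ := by
  have hxy : X (Sum.inl u) * X (Sum.inr u) ∈ twistedEdgeIdeal k σ :=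
    Ideal.subset_span ⟨u, u, le_rfl, by rw [hu]⟩
  apply mem_twistedEdgeIdeal_of_X_sq_mul_mem hσ hu
  · convert add_mem (Ideal.mul_mem_left _ (X (Sum.inl u)) h) (Ideal.mul_mem_left _ f hxy) using 1
    ring
  · convert sub_mem (Ideal.mul_mem_left _ f hxy) (Ideal.mul_mem_left _ (X (Sum.inr u)) h) using 1
    ring

open Classical in
/-- The variable to which `x_{(w,2)}` is sent when `x_{(v,1)}` and `x_{(v,2)}` are identified
for all `v ∈ S`. -/
noncomputable def identifiedVar (S : Set V) (w : V) : V ⊕ V :=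
  if w ∈ S then Sum.inl w else Sum.inr w

/-- The edge ideal together with the differences `x_{(v,1)} - x_{(v,2)}` for `v ∈ S`. -/
noncomputable def edgeIdealWithDiffs (k : Type*) [Field k] (S : Set V) :
    Ideal (MvPolynomial (V ⊕ V) k) :=
  posetEdgeIdeal k V ⊔
    Ideal.span ((fun v => X (Sum.inl v) - X (Sum.inr v)) '' S)

lemma sub_rename_mem_edgeIdealWithDiffs (S : Set V) (f : MvPolynomial (V ⊕ V) k) :
    f - rename (Sum.elim Sum.inl (identifiedVar S)) f ∈ edgeIdealWithDiffs k S := by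
  rw [← Ideal.Quotient.mk_eq_mk_iff_sub_mem]
  suffices h : Ideal.Quotient.mkₐ k (edgeIdealWithDiffs k S) =
      (Ideal.Quotient.mkₐ k (edgeIdealWithDiffs k S)).comp
        (rename (Sum.elim Sum.inl (identifiedVar S))) from
    DFunLike.congr_fun h f
  ext (v | v)
  · simp
  · by_cases hv : v ∈ S
    · simp only [Ideal.Quotient.mkₐ_eq_mk, AlgHom.comp_apply, rename_X, Sum.elim_inr,
        identifiedVar, if_pos hv]
      refine ((Ideal.Quotient.mk_eq_mk_iff_sub_mem _ _).2 ?_).symm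
      exact Ideal.mem_sup_right (Ideal.subset_span ⟨v, hv, rfl⟩)
    · simp [identifiedVar, hv]

lemma mem_edgeIdealWithDiffs_iff (S : Set V) (f : MvPolynomial (V ⊕ V) k) :
    f ∈ edgeIdealWithDiffs k S ↔
      rename (Sum.elim Sum.inl (identifiedVar S)) f ∈ twistedEdgeIdeal k (identifiedVar S) := by
  constructor
  · intro hf
    suffices h : edgeIdealWithDiffs k S ≤ (twistedEdgeIdeal k (identifiedVar S)).comap
        (rename (Sum.elim Sum.inl (identifiedVar S))) from h hf
    refine sup_le (Ideal.span_le.2 ?_) (Ideal.span_le.2 ?_)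
    · rintro _ ⟨v, w, hvw, rfl⟩
      exact Ideal.subset_span ⟨v, w, hvw, by simp⟩
    · rintro _ ⟨v, hv, rfl⟩
      simp [identifiedVar, hv]
  · intro hf
    suffices h : twistedEdgeIdeal k (identifiedVar S) ≤ edgeIdealWithDiffs k S by
      simpa using add_mem (sub_rename_mem_edgeIdealWithDiffs S f) (h hf)
    refine Ideal.span_le.2 ?_
    rintro _ ⟨v, w, hvw, rfl⟩
    have hmem : X (Sum.inl v) * X (Sum.inr w) ∈ edgeIdealWithDiffs k S :=
      Ideal.mem_sup_left (Ideal.subset_span ⟨v, w, hvw, rfl⟩)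
    have hsub := sub_rename_mem_edgeIdealWithDiffs (k := k) S (X (Sum.inl v) * X (Sum.inr w))
    rw [map_mul, rename_X, rename_X, Sum.elim_inl, Sum.elim_inr] at hsub
    exact ((edgeIdealWithDiffs k S).sub_mem_iff_right hmem).1 hsub

lemma mem_edgeIdealWithDiffs_of_X_sub_X_mul_mem {S : Set V} {u : V} (hu : u ∉ S)
    {f : MvPolynomial (V ⊕ V) k}
    (h : (X (Sum.inl u) - X (Sum.inr u)) * f ∈ edgeIdealWithDiffs k S) :
    f ∈ edgeIdealWithDiffs k S := by
  rw [mem_edgeIdealWithDiffs_iff] at h ⊢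
  have hu' : identifiedVar S u = Sum.inr u := by simp [identifiedVar, hu]
  refine mem_twistedEdgeIdeal_of_X_sub_X_mul_mem (fun w => ?_) hu' (by simpa [hu'] using h)
  by_cases hw : w ∈ S <;> simp [identifiedVar, hw]

lemma edgeIdealWithDiffs_ne_top (S : Set V) : edgeIdealWithDiffs k S ≠ ⊤ := by
  suffices h : edgeIdealWithDiffs k S ≤ RingHom.ker (constantCoeff (R := k) (σ := V ⊕ V)) from
    fun htop => RingHom.ker_ne_top _ (top_le_iff.1 (htop ▸ h))
  refine sup_le (Ideal.span_le.2 ?_) (Ideal.span_le.2 ?_)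
  · rintro _ ⟨v, w, hvw, rfl⟩
    simp
  · rintro _ ⟨v, hv, rfl⟩
    simp

variable (k) in
/-- The class of `x_{(v,1)} - x_{(v,2)}` in the edge ring. -/
noncomputable def edgeRingDiff (v : V) : MvPolynomial (V ⊕ V) k ⧸ posetEdgeIdeal k V :=
  Ideal.Quotient.mk _ (X (Sum.inl v) - X (Sum.inr v))

lemma mk_mem_span_edgeRingDiff_iff (S : Set V) (f : MvPolynomial (V ⊕ V) k) :
    Ideal.Quotient.mk (posetEdgeIdeal k V) f ∈ Ideal.span (edgeRingDiff k '' S) ↔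
      f ∈ edgeIdealWithDiffs k S := by
  have h : Ideal.span (edgeRingDiff k '' S) = (Ideal.span
      ((fun v => (X (Sum.inl v) - X (Sum.inr v) : MvPolynomial (V ⊕ V) k)) '' S)).map
        (Ideal.Quotient.mk (posetEdgeIdeal k V)) := by
    rw [Ideal.map_span, Set.image_image]
    rfl
  rw [h, ← Ideal.mem_comap, Ideal.comap_map_of_surjective' _ Ideal.Quotient.mk_surjective,
    Ideal.mk_ker, sup_comm]
  rfl

lemma isRegularSeq_map_edgeRingDiff {vs : List V} (hvs : vs.Nodup) :
    IsRegularSeq (vs.map (edgeRingDiff k)) := by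
  have hspan (i : ℕ) : {a | a ∈ (vs.map (edgeRingDiff k)).take i} =
      edgeRingDiff k '' {v | v ∈ vs.take i} := by
    ext a
    simp [← List.map_take]
  refine ⟨fun i b hb => ?_, fun i _ => ?_⟩
  · obtain ⟨f, rfl⟩ := Ideal.Quotient.mk_surjective b
    have hi : i.val < vs.length := by simpa using i.isLt
    rw [Ideal.Quotient.eq_zero_iff_mem, hspan] at hb ⊢
    rw [mk_mem_span_edgeRingDiff_iff]
    have hu : vs[i.val] ∉ {v | v ∈ vs.take i.val} := by
      intro hmem
      obtain ⟨j, hj, hji⟩ := List.mem_take_iff_getElem.1 hmem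
      have := (hvs.getElem_inj_iff).1 hji
      omega
    refine mem_edgeIdealWithDiffs_of_X_sub_X_mul_mem hu ?_
    rw [← mk_mem_span_edgeRingDiff_iff]
    simpa [edgeRingDiff] using hb
  · rw [hspan, Ideal.ne_top_iff_one, ← map_one (Ideal.Quotient.mk (posetEdgeIdeal k V)),
      mk_mem_span_edgeRingDiff_iff, ← Ideal.ne_top_iff_one]
    exact edgeIdealWithDiffs_ne_top _

lemma mk_X_inl_mul_X_inr (v : V) :
    Ideal.Quotient.mk (posetEdgeIdeal k V) (X (Sum.inl v)) *
      Ideal.Quotient.mk (posetEdgeIdeal k V) (X (Sum.inr v)) = 0 := by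
  rw [← map_mul, Ideal.Quotient.eq_zero_iff_mem]
  exact Ideal.subset_span ⟨v, v, le_rfl, rfl⟩

end Regularity

section Integrality

lemma RingHom.IsIntegral.of_mvPolynomial {B A R σ : Type*} [CommRing B] [CommRing A] [CommRing R]
    (f : B →+* A) {g : MvPolynomial σ R →+* A} (hg : Function.Surjective g)
    (hC : ∀ c, f.IsIntegralElem (g (C c))) (hX : ∀ i, f.IsIntegralElem (g (X i))) :
    f.IsIntegral := by
  intro a
  obtain ⟨p, rfl⟩ := hg a
  induction p using MvPolynomial.induction_on with
  | C c => exact hC c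
  | add p q hp hq => rw [map_add]; exact hp.add f hq
  | mul_X p i hp => rw [map_mul]; exact hp.mul f (hX i)

lemma RingHom.isIntegralElem_of_mul_eq_zero {B A : Type*} [CommRing B] [CommRing A]
    (f : B →+* A) {x y : A} (hxy : x * y = 0) {b : B} (hb : f b = x - y) :
    f.IsIntegralElem x := by
  refine ⟨Polynomial.X ^ 2 - Polynomial.C b * Polynomial.X, by monicity!, ?_⟩
  simp only [Polynomial.eval₂_sub, Polynomial.eval₂_mul, Polynomial.eval₂_pow,
    Polynomial.eval₂_X, Polynomial.eval₂_C, hb]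
  linear_combination hxy

lemma RingHom.IsIntegral.ringKrullDim_le {B A : Type*} [CommRing B] [CommRing A]
    {f : B →+* A} (hf : f.IsIntegral) : ringKrullDim A ≤ ringKrullDim B := by
  let := f.toAlgebra
  have : Algebra.IsIntegral B A := ⟨hf⟩
  exact Order.krullDim_le_of_strictMono (PrimeSpectrum.comap f) fun I J hIJ =>
    Ideal.IsIntegral.comap_lt_comap (R := B) hIJ

variable {k V : Type*} [Field k] [PartialOrder V]

lemma isIntegral_of_map_eq_edgeRingDiff {B A : Type*} [CommRing B] [CommRing A] (f : B →+* A)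
    {g : MvPolynomial (V ⊕ V) k ⧸ posetEdgeIdeal k V →+* A} (hg : Function.Surjective g)
    (hC : ∀ c, ∃ b, f b = g (Ideal.Quotient.mk _ (C c)))
    (hdiff : ∀ v, ∃ b, f b = g (edgeRingDiff k v)) : f.IsIntegral := by
  refine .of_mvPolynomial f (g := g.comp (Ideal.Quotient.mk _))
    (hg.comp Ideal.Quotient.mk_surjective) (fun c => ?_) ?_
  · obtain ⟨b, hb⟩ := hC c
    rw [RingHom.comp_apply, ← hb]
    exact f.isIntegralElem_map
  rintro (v | v) <;> obtain ⟨b, hb⟩ := hdiff v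
  · refine f.isIntegralElem_of_mul_eq_zero (y := g (Ideal.Quotient.mk _ (X (Sum.inr v)))) (b := b)
      ?_ ?_
    · rw [RingHom.comp_apply, ← map_mul, mk_X_inl_mul_X_inr, map_zero]
    · simp [hb, edgeRingDiff]
  · refine f.isIntegralElem_of_mul_eq_zero (y := g (Ideal.Quotient.mk _ (X (Sum.inl v)))) (b := -b)
      ?_ ?_
    · rw [RingHom.comp_apply, ← map_mul, mul_comm, mk_X_inl_mul_X_inr, map_zero]
    · simp [hb, edgeRingDiff]

lemma finiteDimensional_of_edgeRingDiff_eq_zero [Finite V] {A : Type*} [CommRing A] [Algebra k A]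
    (g : (MvPolynomial (V ⊕ V) k ⧸ posetEdgeIdeal k V) →ₐ[k] A) (hg : Function.Surjective g)
    (hdiff : ∀ v, g (edgeRingDiff k v) = 0) : FiniteDimensional k A := by
  have : Algebra.FiniteType k A := .of_surjective g hg
  have : Algebra.IsIntegral k A :=
    ⟨isIntegral_of_map_eq_edgeRingDiff (algebraMap k A) (g := g.toRingHom) hg
      (fun c => ⟨c, (g.commutes c).symm⟩) fun v => ⟨0, (map_zero _).trans (hdiff v).symm⟩⟩
  exact Algebra.IsIntegral.finite

lemma finiteDimensional_quotient_of_edgeRingDiff_mem [Finite V]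
    {I : Ideal (MvPolynomial (V ⊕ V) k ⧸ posetEdgeIdeal k V)} (hI : ∀ v, edgeRingDiff k v ∈ I) :
    FiniteDimensional k ((MvPolynomial (V ⊕ V) k ⧸ posetEdgeIdeal k V) ⧸ I) :=
  finiteDimensional_of_edgeRingDiff_eq_zero (k := k) (V := V)
    (A := (MvPolynomial (V ⊕ V) k ⧸ posetEdgeIdeal k V) ⧸ I) (Ideal.Quotient.mkₐ k I)
    (Ideal.Quotient.mkₐ_surjective k I) fun v => Ideal.Quotient.eq_zero_iff_mem.2 (hI v)

lemma ringKrullDim_edgeRing [Finite V] :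
    ringKrullDim (MvPolynomial (V ⊕ V) k ⧸ posetEdgeIdeal k V) = Nat.card V := by
  have hdim : ringKrullDim (MvPolynomial V k) = Nat.card V := by
    simp [MvPolynomial.ringKrullDim_of_isNoetherianRing]
  apply le_antisymm <;> rw [← hdim]
  · refine RingHom.IsIntegral.ringKrullDim_le
      (f := (aeval (R := k) (edgeRingDiff k (V := V))).toRingHom) ?_
    refine isIntegral_of_map_eq_edgeRingDiff _ (g := RingHom.id _) Function.surjective_id
      (fun c => ⟨C c, (aeval (R := k) (edgeRingDiff k (V := V))).commutes c⟩)
      fun v => ⟨X v, aeval_X _ v⟩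
  · let g : MvPolynomial (V ⊕ V) k →ₐ[k] MvPolynomial V k := aeval (Sum.elim 0 X)
    have hg : ∀ p ∈ posetEdgeIdeal k V, g p = 0 := by
      suffices h : posetEdgeIdeal k V ≤ RingHom.ker g from fun p hp => h hp
      refine Ideal.span_le.2 ?_
      rintro _ ⟨v, w, hvw, rfl⟩
      simp [g]
    refine ringKrullDim_le_of_surjective (Ideal.Quotient.lift _ g.toRingHom hg)
      (Ideal.Quotient.lift_surjective_of_surjective _ hg fun p => ⟨rename Sum.inr p, ?_⟩)
    change aeval (Sum.elim 0 X) (rename Sum.inr p) = p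
    rw [aeval_rename, Sum.elim_comp_inr, aeval_X_left, AlgHom.id_apply]

end Integrality

/-- For a finite poset `(V, ≤)`, the edge ring `A = k[V×{1,2}]/L` of the
associated bipartite graph is Cohen–Macaulay: there is a regular sequence of
length `|V|` whose quotient is a finite-dimensional `k`-vector space; moreover,
the Krull dimension of `A` equals `|V|`. -/
theorem poset_edge_ring_cohenMacaulay
    {k V : Type*} [Field k] [Fintype V] [PartialOrder V] :
    (∃ l : List (MvPolynomial (V ⊕ V) k ⧸ posetEdgeIdeal k V),
      l.length = Fintype.card V ∧ IsRegularSeq l ∧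
      FiniteDimensional k
        ((MvPolynomial (V ⊕ V) k ⧸ posetEdgeIdeal k V) ⧸
          Ideal.span {a | a ∈ l})) ∧
    ringKrullDim (MvPolynomial (V ⊕ V) k ⧸ posetEdgeIdeal k V) =
      Fintype.card V := by
  refine ⟨⟨Finset.univ.toList.map (edgeRingDiff k), by simp,
    isRegularSeq_map_edgeRingDiff (Finset.nodup_toList _),
    finiteDimensional_quotient_of_edgeRingDiff_mem fun v => Ideal.subset_span (by simp)⟩, ?_⟩
  rw [ringKrullDim_edgeRing, Nat.card_eq_fintype_card]
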